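/- Let p ≤ q be coprime positive integers. For every n ≥ 1, log N_n − log N_{n−1} ≤ ∑_{z ∈ Z_n} sup_{ω ∈ [z]} φ(ω), where [z] is the cylinder set of sequences ω ∈ X_θ whose first n letters equal z. -/

import Mathlib

/-- The four matrices `A_b` indexed by `B = {(0,0),(1,0),(0,1),(1,1)}`
(encoded as `Bool × Bool`, `false ↦ 0`, `true ↦ 1`), with real entries. -/
def Amat : Bool × Bool → Matrix (Fin 4) (Fin 4) ℝ
  | (false, false) => !![3,1,1,1; 0,1,0,0; 0,0,1,0; 0,0,0,1]
  | (true, false)  => !![1,0,1,0; 1,3,0,1; 0,0,0,0; 0,0,1,1]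
  | (false, true)  => !![1,1,0,0; 0,0,0,0; 1,0,3,1; 0,1,0,1]
  | (true, true)   => !![1,0,0,0; 0,1,0,0; 0,0,1,0; 1,1,1,3]

/-- `W(ω_1⋯ω_n) = (1,1,1,1) · A_{ω_1}⋯A_{ω_n} · (1,0,0,0)ᵀ` for the length-`n`
prefix of the sequence `ω`. -/
def Wpre (ω : ℕ → Bool × Bool) (n : ℕ) : ℝ :=
  ∑ i : Fin 4, ((List.ofFn fun k : Fin n => Amat (ω k)).prod) i 0

/-- The potential `φ(ω) = limsup_n log( W(ω_1⋯ω_n)/W(ω_2⋯ω_n) )`. -/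
noncomputable def phi (ω : ℕ → Bool × Bool) : ℝ :=
  Filter.limsup (fun n => Real.log (Wpre ω n / Wpre (fun i => ω (i + 1)) (n - 1)))
    Filter.atTop

/-- `X_θ`: sequences `ω ∈ B^ℕ` whose associated point
`(∑ ω_{i,1} 2^{-i}, ∑ ω_{i,2} 2^{-i})` lies on the extended line
`l_{p/q} = {(t mod 1, (p/q)·t mod 1) : t ∈ ℝ}`. -/
def Xtheta (p q : ℕ) : Set (ℕ → Bool × Bool) :=
  {ω | ∃ t : ℝ,
    Int.fract t = ∑' i : ℕ, (if (ω i).1 then (1 : ℝ) else 0) / 2 ^ (i + 1) ∧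
    Int.fract ((p : ℝ) / (q : ℝ) * t)
      = ∑' i : ℕ, (if (ω i).2 then (1 : ℝ) else 0) / 2 ^ (i + 1)}

/-- `Z_n`: words `z ∈ B^n` with `p·∑ z_{i,1} 2^{n-i} = q·∑ z_{i,2} 2^{n-i}`. -/
def Zset (p q n : ℕ) : Finset (Fin n → Bool × Bool) :=
  Finset.univ.filter fun z =>
    p * ∑ i : Fin n, (if (z i).1 then 1 else 0) * 2 ^ (n - 1 - (i : ℕ))
      = q * ∑ i : Fin n, (if (z i).2 then 1 else 0) * 2 ^ (n - 1 - (i : ℕ))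

/-- The digit set `D = {0, 1, p/q} ⊆ ℚ`. -/
def Dset (p q : ℕ) : Finset ℚ := {0, 1, (p : ℚ) / (q : ℚ)}

/-- Words of length `n` over `D`. -/
def Dwords (p q n : ℕ) : Finset (Fin n → ℚ) :=
  Fintype.piFinset fun _ => Dset p q

/-- The value `∑_{i=1}^n a_i 2^{-i}` of a word. -/
def valD {n : ℕ} (a : Fin n → ℚ) : ℚ :=
  ∑ i : Fin n, a i / 2 ^ ((i : ℕ) + 1)

/-- `N_n`: the number of exactly-overlapping pairs `(a,b) ∈ D^n × D^n`. -/
def Ncount (p q n : ℕ) : ℕ :=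
  (((Dwords p q n) ×ˢ (Dwords p q n)).filter fun ab => valD ab.1 = valD ab.2).card

section Potential

lemma Amat_nonneg (b : Bool × Bool) (i j : Fin 4) : 0 ≤ Amat b i j := by
  rcases b with ⟨_ | _, _ | _⟩ <;> fin_cases i <;> fin_cases j <;> simp [Amat]

lemma Amat_colSum_bounds (b : Bool × Bool) (j : Fin 4) :
    2 ≤ ∑ i, Amat b i j ∧ ∑ i, Amat b i j ≤ 3 := by
  rcases b with ⟨_ | _, _ | _⟩ <;> fin_cases j <;>
    simp [Amat, Fin.sum_univ_succ] <;> norm_num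

lemma Amat_prod_nonneg (ω : ℕ → Bool × Bool) (n : ℕ) (i j : Fin 4) :
    0 ≤ (List.ofFn fun k : Fin n => Amat (ω k)).prod i j := by
  induction n generalizing ω i j with
  | zero =>
    simp only [List.ofFn_zero, List.prod_nil, Matrix.one_apply]
    split_ifs <;> norm_num
  | succ n ih =>
    rw [List.ofFn_succ, List.prod_cons, Matrix.mul_apply]
    exact Finset.sum_nonneg fun k _ =>
      mul_nonneg (Amat_nonneg _ _ _) (ih (fun m => ω (m + 1)) k j)

lemma Wpre_succ (ω : ℕ → Bool × Bool) (n : ℕ) :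
    Wpre ω (n + 1) = ∑ j, (∑ i, Amat (ω 0) i j) *
      (List.ofFn fun k : Fin n => Amat (ω (k + 1))).prod j 0 := by
  simp only [Wpre, List.ofFn_succ, List.prod_cons, Matrix.mul_apply, Finset.sum_mul]
  rw [Finset.sum_comm]
  rfl

lemma two_mul_Wpre_le (ω : ℕ → Bool × Bool) (n : ℕ) :
    2 * Wpre (fun i => ω (i + 1)) n ≤ Wpre ω (n + 1) := by
  rw [Wpre_succ, Wpre, Finset.mul_sum]
  exact Finset.sum_le_sum fun j _ => mul_le_mul_of_nonneg_right
    (Amat_colSum_bounds _ j).1 (Amat_prod_nonneg (fun m => ω (m + 1)) n j 0)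

lemma Wpre_le_three_mul (ω : ℕ → Bool × Bool) (n : ℕ) :
    Wpre ω (n + 1) ≤ 3 * Wpre (fun i => ω (i + 1)) n := by
  rw [Wpre_succ, Wpre, Finset.mul_sum]
  exact Finset.sum_le_sum fun j _ => mul_le_mul_of_nonneg_right
    (Amat_colSum_bounds _ j).2 (Amat_prod_nonneg (fun m => ω (m + 1)) n j 0)

lemma Wpre_pos (ω : ℕ → Bool × Bool) (n : ℕ) : 0 < Wpre ω n := by
  induction n generalizing ω with
  | zero => simp [Wpre, Matrix.one_apply]
  | succ n ih => linarith [two_mul_Wpre_le ω n, ih fun i => ω (i + 1)]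

lemma log_Wpre_ratio_bounds (ω : ℕ → Bool × Bool) {n : ℕ} (hn : 1 ≤ n) :
    Real.log 2 ≤ Real.log (Wpre ω n / Wpre (fun i => ω (i + 1)) (n - 1)) ∧
      Real.log (Wpre ω n / Wpre (fun i => ω (i + 1)) (n - 1)) ≤ Real.log 3 := by
  obtain ⟨m, rfl⟩ := Nat.exists_eq_add_of_le' hn
  rw [Nat.add_sub_cancel]
  have hW := Wpre_pos (fun i => ω (i + 1)) m
  constructor
  · exact Real.log_le_log two_pos ((le_div_iff₀ hW).2 (two_mul_Wpre_le ω m))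
  · exact Real.log_le_log (div_pos (Wpre_pos ω _) hW)
      ((div_le_iff₀ hW).2 (Wpre_le_three_mul ω m))

lemma phi_le_log_three (ω : ℕ → Bool × Bool) : phi ω ≤ Real.log 3 := by
  refine Filter.limsup_le_of_le ?_ ?_
  · exact Filter.IsBoundedUnder.isCoboundedUnder_le ⟨Real.log 2, Filter.eventually_map.2 <|
      (Filter.eventually_ge_atTop 1).mono fun n hn => (log_Wpre_ratio_bounds ω hn).1⟩
  · exact (Filter.eventually_ge_atTop 1).mono fun n hn => (log_Wpre_ratio_bounds ω hn).2

lemma log_two_le_phi (ω : ℕ → Bool × Bool) : Real.log 2 ≤ phi ω := by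
  refine Filter.le_limsup_of_frequently_le ?_ ?_
  · exact ((Filter.eventually_ge_atTop 1).mono
      fun n hn => (log_Wpre_ratio_bounds ω hn).1).frequently
  · exact ⟨Real.log 3, Filter.eventually_map.2 <|
      (Filter.eventually_ge_atTop 1).mono fun n hn => (log_Wpre_ratio_bounds ω hn).2⟩

lemma Amat_zero_pow_col (n : ℕ) (i : Fin 4) :
    (Amat (false, false) ^ n) i 0 = if i = 0 then 3 ^ n else 0 := by
  induction n generalizing i with
  | zero => simp [Matrix.one_apply]
  | succ n ih =>
    rw [pow_succ', Matrix.mul_apply]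
    simp only [ih, mul_ite, mul_zero, Finset.sum_ite_eq', Finset.mem_univ, if_true]
    fin_cases i <;> simp [Amat, pow_succ']

lemma Wpre_zero (n : ℕ) : Wpre (fun _ => (false, false)) n = 3 ^ n := by
  simp only [Wpre, List.ofFn_const, List.prod_replicate, Amat_zero_pow_col]
  simp

lemma phi_zero : phi (fun _ => (false, false)) = Real.log 3 := by
  unfold phi
  have h : (fun n => Real.log (Wpre (fun _ => (false, false)) n /
      Wpre (fun _ => (false, false)) (n - 1))) =ᶠ[Filter.atTop] fun _ => Real.log 3 := by
    filter_upwards [Filter.eventually_ge_atTop 1] with n hn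
    obtain ⟨m, rfl⟩ := Nat.exists_eq_add_of_le' hn
    rw [Wpre_zero, Wpre_zero, Nat.add_sub_cancel, pow_succ, mul_div_cancel_left₀ _ (by positivity)]
  rw [Filter.limsup_congr h, Filter.limsup_const]

end Potential

section Cylinder

/-- The word `z` followed by zeros. -/
def padZeros {n : ℕ} (z : Fin n → Bool × Bool) (k : ℕ) : Bool × Bool :=
  if h : k < n then z ⟨k, h⟩ else (false, false)

lemma sum_bits_lt {n : ℕ} (f : Fin n → Bool) :
    ∑ i, (if f i then 1 else 0) * 2 ^ (n - 1 - (i : ℕ)) < 2 ^ n := by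
  induction n with
  | zero => simp
  | succ n ih =>
    have := ih fun i => f i.succ
    rw [Fin.sum_univ_succ, pow_succ]
    have h : ∀ i : Fin n, n + 1 - 1 - ((i.succ : Fin (n + 1)) : ℕ) = n - 1 - (i : ℕ) := by
      intro i; simp; omega
    simp only [h]
    simp only [Fin.val_zero, Nat.add_sub_cancel, Nat.sub_zero]
    split_ifs <;> omega

lemma exists_bits {n m : ℕ} (hm : m < 2 ^ n) :
    ∃ f : Fin n → Bool, ∑ i, (if f i then 1 else 0) * 2 ^ (n - 1 - (i : ℕ)) = m := by
  induction n generalizing m with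
  | zero => exact ⟨fun _ => false, by simp at hm ⊢; omega⟩
  | succ n ih =>
    have h : ∀ i : Fin n, n + 1 - 1 - ((i.succ : Fin (n + 1)) : ℕ) = n - 1 - (i : ℕ) := by
      intro i; simp; omega
    rw [pow_succ] at hm
    by_cases hmn : m < 2 ^ n
    · obtain ⟨f, hf⟩ := ih hmn
      refine ⟨Fin.cons false f, ?_⟩
      rw [Fin.sum_univ_succ]
      simp only [h, Fin.cons_succ, hf]
      simp
    · obtain ⟨f, hf⟩ := ih (m := m - 2 ^ n) (by omega)
      refine ⟨Fin.cons true f, ?_⟩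
      rw [Fin.sum_univ_succ]
      simp only [h, Fin.cons_succ, hf]
      simp
      omega

lemma tsum_padded_bits {n : ℕ} (g : ℕ → Bool) (f : Fin n → Bool)
    (hg : ∀ i : Fin n, g i = f i) (hg' : ∀ k, n ≤ k → g k = false) :
    ∑' k : ℕ, (if g k then (1 : ℝ) else 0) / 2 ^ (k + 1) =
      ((∑ i, (if f i then 1 else 0) * 2 ^ (n - 1 - (i : ℕ)) : ℕ) : ℝ) / 2 ^ n := by
  rw [tsum_eq_sum (s := Finset.range n) fun k hk => by
    simp [hg' k (by simpa using hk)], Finset.sum_range]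
  push_cast
  rw [Finset.sum_div]
  refine Finset.sum_congr rfl fun i _ => ?_
  rw [hg i]
  have h : (2 : ℝ) ^ n = 2 ^ (n - 1 - (i : ℕ)) * 2 ^ ((i : ℕ) + 1) := by
    rw [← pow_add]; congr 1; omega
  split_ifs
  · rw [h]; field_simp
  · simp

lemma padZeros_mem_Xtheta {p q n : ℕ} (hq : 0 < q) {z : Fin n → Bool × Bool}
    (hz : z ∈ Zset p q n) : padZeros z ∈ Xtheta p q := by
  have hz' := (Finset.mem_filter.1 hz).2
  have h1 := tsum_padded_bits (fun k => (padZeros z k).1) (fun i => (z i).1)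
    (fun i => by simp [padZeros]) (fun k hk => by simp [padZeros, not_lt.2 hk])
  have h2 := tsum_padded_bits (fun k => (padZeros z k).2) (fun i => (z i).2)
    (fun i => by simp [padZeros]) (fun k hk => by simp [padZeros, not_lt.2 hk])
  have l1 := sum_bits_lt fun i => (z i).1
  have l2 := sum_bits_lt fun i => (z i).2
  have hfract : ∀ a : ℕ, a < 2 ^ n → Int.fract ((a : ℝ) / 2 ^ n) = (a : ℝ) / 2 ^ n :=
    fun a ha => Int.fract_eq_self.2 ⟨by positivity,
      (div_lt_one (by positivity)).2 (by exact_mod_cast ha)⟩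
  generalize ∑ i, (if (z i).1 then 1 else 0) * 2 ^ (n - 1 - (i : ℕ)) = a at *
  generalize ∑ i, (if (z i).2 then 1 else 0) * 2 ^ (n - 1 - (i : ℕ)) = b at *
  refine ⟨(a : ℝ) / 2 ^ n, by rw [h1, hfract a l1], ?_⟩
  have hab : (p : ℝ) / q * (a / 2 ^ n) = (b : ℝ) / 2 ^ n := by
    have : (p : ℝ) * a = q * b := by exact_mod_cast hz'
    field_simp
    linarith
  rw [hab, h2, hfract b l2]

lemma phi_padZeros_le_sSup {p q n : ℕ} (hq : 0 < q) {z : Fin n → Bool × Bool}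
    (hz : z ∈ Zset p q n) :
    phi (padZeros z) ≤
      sSup (phi '' {ω | ω ∈ Xtheta p q ∧ ∀ i : Fin n, ω (i : ℕ) = z i}) := by
  refine le_csSup ⟨Real.log 3, ?_⟩ ⟨padZeros z, ⟨padZeros_mem_Xtheta hq hz, ?_⟩, rfl⟩
  · rintro _ ⟨ω, -, rfl⟩
    exact phi_le_log_three ω
  · intro i
    simp [padZeros]

lemma zero_mem_Zset (p q n : ℕ) : (fun _ => (false, false)) ∈ Zset p q n := by
  simp [Zset]

lemma sum_phi_padZeros_le_sum_sSup {p q n : ℕ} (hq : 0 < q) {s : Finset (Fin n → Bool × Bool)}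
    (hs : s ⊆ Zset p q n) :
    ∑ z ∈ s, phi (padZeros z) ≤ ∑ z ∈ Zset p q n,
      sSup (phi '' {ω | ω ∈ Xtheta p q ∧ ∀ i : Fin n, ω (i : ℕ) = z i}) := by
  refine (Finset.sum_le_sum fun z hz => phi_padZeros_le_sSup hq (hs hz)).trans ?_
  refine Finset.sum_le_sum_of_subset_of_nonneg hs fun z hz _ => ?_
  exact (Real.log_nonneg one_le_two).trans
    ((log_two_le_phi _).trans (phi_padZeros_le_sSup hq hz))

lemma phi_padZeros_zero (n : ℕ) :
    phi (padZeros fun _ : Fin n => (false, false)) = Real.log 3 := by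
  rw [← phi_zero]
  congr 1
  funext k
  simp [padZeros]

lemma log_three_le_sum_sSup {p q : ℕ} (hq : 0 < q) (n : ℕ) :
    Real.log 3 ≤ ∑ z ∈ Zset p q n,
      sSup (phi '' {ω | ω ∈ Xtheta p q ∧ ∀ i : Fin n, ω (i : ℕ) = z i}) := by
  have h := sum_phi_padZeros_le_sum_sSup hq
    (Finset.singleton_subset_iff.2 (zero_mem_Zset p q n))
  rwa [Finset.sum_singleton, phi_padZeros_zero] at h

lemma log_six_le_sum_sSup {p q n : ℕ} (hp : 0 < p) (hpq : p ≤ q) (hqn : q < 2 ^ n) :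
    Real.log 6 ≤ ∑ z ∈ Zset p q n,
      sSup (phi '' {ω | ω ∈ Xtheta p q ∧ ∀ i : Fin n, ω (i : ℕ) = z i}) := by
  obtain ⟨f, hf⟩ := exists_bits hqn
  obtain ⟨g, hg⟩ := exists_bits (hpq.trans_lt hqn)
  set z : Fin n → Bool × Bool := fun i => (f i, g i) with hz
  have hzmem : z ∈ Zset p q n := by
    simp only [Zset, Finset.mem_filter, Finset.mem_univ, true_and, hz]
    rw [hf, hg, mul_comm]
  have hne : (fun _ => (false, false)) ≠ z := by
    intro h
    have hf0 : ∀ i, f i = false := fun i => (congrArg Prod.fst (congrFun h i)).symm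
    simp only [hf0] at hf
    simp at hf
    omega
  have h := sum_phi_padZeros_le_sum_sSup (hp.trans_le hpq) (s := {fun _ => (false, false), z})
    (Finset.insert_subset (zero_mem_Zset p q n) (Finset.singleton_subset_iff.2 hzmem))
  rw [Finset.sum_pair hne, phi_padZeros_zero] at h
  have h6 : Real.log 6 = Real.log 3 + Real.log 2 := by
    rw [← Real.log_mul (by norm_num) (by norm_num)]; norm_num
  linarith [log_two_le_phi (padZeros z)]

end Cylinder

section Counting

lemma card_filter_eq_eq_sum {α β : Type*} [DecidableEq β] (A : Finset α) (f g : α → β)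
    {T : Finset β} (hT : ∀ a ∈ A, f a ∈ T) :
    ((A ×ˢ A).filter fun x => f x.1 = g x.2).card =
      ∑ v ∈ T, (A.filter fun a => f a = v).card * (A.filter fun a => g a = v).card := by
  rw [Finset.card_eq_sum_card_fiberwise (f := fun x => f x.1) (t := T)]
  · refine Finset.sum_congr rfl fun v _ => ?_
    rw [← Finset.card_product]
    congr 1
    ext x
    simp only [Finset.mem_filter, Finset.mem_product]
    constructor
    · rintro ⟨⟨⟨h1, h2⟩, h3⟩, h4⟩
      exact ⟨⟨h1, h4⟩, h2, h3 ▸ h4⟩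
    · rintro ⟨⟨h1, h4⟩, h2, h3⟩
      exact ⟨⟨⟨h1, h2⟩, h4.trans h3.symm⟩, h4⟩
  · intro x hx
    have hx' := Finset.mem_filter.1 (Finset.mem_coe.1 hx)
    exact hT _ (Finset.mem_product.1 hx'.1).1

lemma two_mul_card_filter_eq_le {α β : Type*} [DecidableEq β] (A : Finset α) (f g : α → β) :
    2 * ((A ×ˢ A).filter fun x => f x.1 = g x.2).card ≤
      ((A ×ˢ A).filter fun x => f x.1 = f x.2).card +
        ((A ×ˢ A).filter fun x => g x.1 = g x.2).card := by
  classical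
  have hf : ∀ a ∈ A, f a ∈ A.image f ∪ A.image g := fun a ha =>
    Finset.mem_union_left _ (Finset.mem_image_of_mem f ha)
  have hg : ∀ a ∈ A, g a ∈ A.image f ∪ A.image g := fun a ha =>
    Finset.mem_union_right _ (Finset.mem_image_of_mem g ha)
  rw [card_filter_eq_eq_sum A f g hf, card_filter_eq_eq_sum A f f hf,
    card_filter_eq_eq_sum A g g hg, ← Finset.sum_add_distrib, Finset.mul_sum]
  refine Finset.sum_le_sum fun v _ => ?_
  nlinarith [two_mul_le_add_sq (A.filter fun a => f a = v).card (A.filter fun a => g a = v).card]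

lemma card_shifted_overlaps_le (p q n : ℕ) (c : ℚ) :
    ((Dwords p q n ×ˢ Dwords p q n).filter fun ab => valD ab.1 = valD ab.2 + c).card ≤
      Ncount p q n := by
  have h := two_mul_card_filter_eq_le (Dwords p q n) (fun a => valD a) (fun a => valD a + c)
  simp only [add_left_inj] at h
  unfold Ncount
  omega

lemma valD_succ {n : ℕ} (a : Fin (n + 1) → ℚ) :
    valD a = valD (Fin.init a) + a (Fin.last n) / 2 ^ (n + 1) := by
  simp [valD, Fin.sum_univ_castSucc, Fin.init]

lemma init_mem_Dwords {p q n : ℕ} {a : Fin (n + 1) → ℚ} (ha : a ∈ Dwords p q (n + 1)) :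
    Fin.init a ∈ Dwords p q n :=
  Fintype.mem_piFinset.2 fun i => Fintype.mem_piFinset.1 ha i.castSucc

lemma last_mem_Dset {p q n : ℕ} {a : Fin (n + 1) → ℚ} (ha : a ∈ Dwords p q (n + 1)) :
    a (Fin.last n) ∈ Dset p q :=
  Fintype.mem_piFinset.1 ha _

lemma Ncount_succ_le {p q n : ℕ} (P : Finset (ℚ × ℚ))
    (hP : ∀ a ∈ Dwords p q (n + 1), ∀ b ∈ Dwords p q (n + 1), valD a = valD b →
      (a (Fin.last n), b (Fin.last n)) ∈ P) :
    Ncount p q (n + 1) ≤ Ncount p q n * P.card := by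
  refine Finset.card_le_mul_card_image_of_maps_to
    (f := fun ab => (ab.1 (Fin.last n), ab.2 (Fin.last n))) ?_ _ ?_
  · intro ab hab
    obtain ⟨h, he⟩ := Finset.mem_filter.1 hab
    obtain ⟨ha, hb⟩ := Finset.mem_product.1 h
    exact hP _ ha _ hb he
  · rintro ⟨x, y⟩ -
    refine le_trans (Finset.card_le_card_of_injOn (fun ab => (Fin.init ab.1, Fin.init ab.2))
      ?_ ?_) (card_shifted_overlaps_le p q n (y / 2 ^ (n + 1) - x / 2 ^ (n + 1)))
    · rintro ⟨a, b⟩ hab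
      simp only [Finset.coe_filter, Finset.mem_filter, Finset.mem_product, Set.mem_ofPred_eq,
        Prod.mk.injEq] at hab ⊢
      obtain ⟨⟨⟨ha, hb⟩, he⟩, rfl, rfl⟩ := hab
      refine ⟨⟨init_mem_Dwords ha, init_mem_Dwords hb⟩, ?_⟩
      rw [valD_succ a, valD_succ b] at he
      linarith
    · rintro ⟨a, b⟩ hab ⟨a', b'⟩ hab' h
      simp only [Finset.coe_filter, Finset.mem_filter, Set.mem_ofPred_eq, Prod.mk.injEq]
        at hab hab' h ⊢
      obtain ⟨-, rfl, rfl⟩ := hab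
      obtain ⟨-, hx, hy⟩ := hab'
      constructor
      · rw [← Fin.snoc_init_self a, ← Fin.snoc_init_self a', h.1, hx]
      · rw [← Fin.snoc_init_self b, ← Fin.snoc_init_self b', h.2, hy]

lemma exists_digit_coords {p q : ℕ} (hq : 0 < q) {x : ℚ} (hx : x ∈ Dset p q) :
    ∃ s t : ℕ, s ≤ 1 ∧ t ≤ 1 ∧ q * x = q * s + p * t := by
  have hq' : (q : ℚ) ≠ 0 := by positivity
  simp only [Dset, Finset.mem_insert, Finset.mem_singleton] at hx
  rcases hx with rfl | rfl | rfl
  · exact ⟨0, 0, by simp⟩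
  · exact ⟨1, 0, by simp⟩
  · exact ⟨0, 1, by simp, by simp, by field_simp; simp⟩

lemma scaled_valD_succ {q n : ℕ} (a : Fin (n + 1) → ℚ) :
    (q : ℚ) * 2 ^ (n + 1) * valD a =
      2 * (q * 2 ^ n * valD (Fin.init a)) + q * a (Fin.last n) := by
  rw [valD_succ]
  field_simp
  ring

lemma exists_valD_coords {p q n : ℕ} (hq : 0 < q) {a : Fin n → ℚ} (ha : a ∈ Dwords p q n) :
    ∃ S T : ℕ, T < 2 ^ n ∧ q * 2 ^ n * valD a = q * S + p * T := by
  induction n with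
  | zero => exact ⟨0, 0, by simp, by simp [valD]⟩
  | succ n ih =>
    obtain ⟨S, T, hT, h⟩ := ih (init_mem_Dwords ha)
    obtain ⟨s, t, -, ht, hx⟩ := exists_digit_coords hq (last_mem_Dset ha)
    refine ⟨2 * S + s, 2 * T + t, by rw [pow_succ]; omega, ?_⟩
    rw [scaled_valD_succ, h, hx]
    push_cast
    ring

lemma Ncount_succ_le_five_mul {p q : ℕ} (hq : 0 < q) (hcop : Nat.Coprime p q) (n : ℕ) :
    Ncount p q (n + 1) ≤ Ncount p q n * 5 := by
  classical
  set e : Fin 3 → ℕ := ![0, q, p] with he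
  set E : Finset (Fin 3 × Fin 3) :=
    Finset.univ.filter fun ij => e ij.1 % 2 = e ij.2 % 2 with hE
  have hcard : E.card ≤ 5 := by
    have hpq : ¬ (p % 2 = 0 ∧ q % 2 = 0) := fun h =>
      Nat.not_coprime_of_dvd_of_dvd one_lt_two (Nat.dvd_of_mod_eq_zero h.1)
        (Nat.dvd_of_mod_eq_zero h.2) hcop
    have hmod : ∀ i, e i % 2 = ![0, q % 2, p % 2] i := by
      intro i; fin_cases i <;> simp [he]
    simp only [hE, hmod]
    rcases Nat.mod_two_eq_zero_or_one p with h1 | h1 <;>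
      rcases Nat.mod_two_eq_zero_or_one q with h2 | h2
    · exact absurd ⟨h1, h2⟩ hpq
    all_goals rw [h1, h2]; decide
  have hD : ∀ x ∈ Dset p q, ∃ i, x = (e i : ℚ) / q := by
    intro x hx
    have hq' : (q : ℚ) ≠ 0 := by positivity
    simp only [Dset, Finset.mem_insert, Finset.mem_singleton] at hx
    rcases hx with rfl | rfl | rfl
    · exact ⟨0, by simp [he]⟩
    · exact ⟨1, by simp [he, hq']⟩
    · exact ⟨2, by simp [he]⟩
  refine (Ncount_succ_le (E.image fun ij => ((e ij.1 : ℚ) / q, (e ij.2 : ℚ) / q)) ?_).trans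
    (Nat.mul_le_mul_left _ (Finset.card_image_le.trans hcard))
  intro a ha b hb hab
  obtain ⟨i, hi⟩ := hD _ (last_mem_Dset ha)
  obtain ⟨j, hj⟩ := hD _ (last_mem_Dset hb)
  obtain ⟨S, T, -, hST⟩ := exists_valD_coords hq (init_mem_Dwords ha)
  obtain ⟨S', T', -, hST'⟩ := exists_valD_coords hq (init_mem_Dwords hb)
  refine Finset.mem_image.2 ⟨(i, j), ?_, by rw [hi, hj]⟩
  have h := congrArg (fun v => (q : ℚ) * 2 ^ (n + 1) * v) hab
  simp only [scaled_valD_succ, hST, hST', hi, hj] at h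
  have hq' : (q : ℚ) ≠ 0 := by positivity
  rw [mul_div_cancel₀ _ hq', mul_div_cancel₀ _ hq'] at h
  have h' : 2 * (q * S + p * T) + e i = 2 * (q * S' + p * T') + e j := by exact_mod_cast h
  simp only [hE, Finset.mem_filter, Finset.mem_univ, true_and]
  omega

lemma Ncount_succ_le_three_mul {p q n : ℕ} (hq : 0 < q) (hcop : Nat.Coprime p q)
    (hqn : 2 ^ (n + 1) ≤ q) : Ncount p q (n + 1) ≤ Ncount p q n * 3 := by
  classical
  refine (Ncount_succ_le ((Dset p q).image fun x => (x, x)) ?_).trans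
    (Nat.mul_le_mul_left _ (Finset.card_image_le.trans Finset.card_le_three))
  intro a ha b hb hab
  refine Finset.mem_image.2 ⟨a (Fin.last n), last_mem_Dset ha, ?_⟩
  obtain ⟨S, T, hT, hST⟩ := exists_valD_coords hq (init_mem_Dwords ha)
  obtain ⟨S', T', hT', hST'⟩ := exists_valD_coords hq (init_mem_Dwords hb)
  obtain ⟨s, t, hs, ht, hst⟩ := exists_digit_coords hq (last_mem_Dset ha)
  obtain ⟨s', t', hs', ht', hst'⟩ := exists_digit_coords hq (last_mem_Dset hb)
  have h := congrArg (fun v => (q : ℚ) * 2 ^ (n + 1) * v) hab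
  simp only [scaled_valD_succ, hST, hST', hst, hst'] at h
  have h' : (2 * (q * S + p * T) + (q * s + p * t) : ℤ) =
    2 * (q * S' + p * T') + (q * s' + p * t') := by exact_mod_cast h
  have hdvd : (q : ℤ) ∣ (2 * T + t : ℕ) - (2 * T' + t' : ℕ) := by
    refine (Nat.isCoprime_iff_coprime.2 hcop.symm).dvd_of_dvd_mul_left
      ⟨2 * S' + s' - (2 * S + s), ?_⟩
    push_cast
    linear_combination h'
  have hpow : 2 ^ (n + 1) = 2 * 2 ^ n := pow_succ' 2 n
  have hTT : ((2 * T + t : ℕ) - (2 * T' + t' : ℕ) : ℤ) = 0 :=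
    Int.eq_zero_of_abs_lt_dvd hdvd (by rw [abs_lt]; constructor <;> omega)
  have hSS : (2 * S + s : ℤ) = 2 * S' + s' := by
    have hq' : (q : ℤ) ≠ 0 := by positivity
    refine mul_left_cancel₀ hq' ?_
    push_cast at hTT
    linear_combination h' - p * hTT
  have hs'' : s = s' := by omega
  have ht'' : t = t' := by omega
  have hlast : a (Fin.last n) = b (Fin.last n) := by
    have hq' : (q : ℚ) ≠ 0 := by positivity
    refine mul_left_cancel₀ hq' ?_
    rw [hst, hst', hs'', ht'']
  rw [← hlast]

lemma Ncount_pos (p q n : ℕ) : 0 < Ncount p q n := by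
  refine Finset.card_pos.2 ⟨(fun _ => 0, fun _ => 0), ?_⟩
  simp [Dwords, Dset]

end Counting

/-- for `n ≥ 1`,
`log N_n - log N_{n-1} ≤ ∑_{z ∈ Z_n} sup_{ω ∈ [z]} φ(ω)`, where `[z]` is the
cylinder of sequences in `X_θ` starting with `z`. -/
theorem stmt_10 (p q : ℕ) (hp : 0 < p) (hq : 0 < q) (hpq : p ≤ q)
    (hcop : Nat.Coprime p q) (n : ℕ) (hn : 1 ≤ n) :
    Real.log (Ncount p q n) - Real.log (Ncount p q (n - 1)) ≤
      ∑ z ∈ Zset p q n,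
        sSup (phi '' {ω | ω ∈ Xtheta p q ∧ ∀ i : Fin n, ω (i : ℕ) = z i}) := by
  obtain ⟨m, rfl⟩ := Nat.exists_eq_add_of_le' hn
  rw [Nat.add_sub_cancel]
  have hpos : ∀ k, (0 : ℝ) < Ncount p q k := fun k => by exact_mod_cast Ncount_pos p q k
  have hlog : ∀ K : ℕ, 0 < K → Ncount p q (m + 1) ≤ Ncount p q m * K →
      Real.log (Ncount p q (m + 1)) - Real.log (Ncount p q m) ≤ Real.log K := by
    intro K hK h
    rw [sub_le_iff_le_add', ← Real.log_mul (hpos m).ne' (by positivity)]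
    exact Real.log_le_log (hpos _) (by exact_mod_cast h)
  rcases lt_or_ge q (2 ^ (m + 1)) with h | h
  · refine (hlog 5 (by norm_num) (Ncount_succ_le_five_mul hq hcop m)).trans
      (le_trans ?_ (log_six_le_sum_sSup hp hpq h))
    exact Real.log_le_log (by norm_num) (by norm_num)
  · exact (hlog 3 (by norm_num) (Ncount_succ_le_three_mul hq hcop h)).trans
      (log_three_le_sum_sSup hq _)
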